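/- Let G be a countable group and H ◁ G a normal subgroup. Let m be a symmetric probability measure on G whose support generates G as a group, and suppose the stopping time τ((g_n)) := inf{n ≥ 1 : g₁⋯g_n ∈ H} is finite for m^ℕ-almost every (g_n) ∈ G^ℕ. Define ξ : G^ℕ → H (m^ℕ-a.e.) by ξ((g_n)) = g₁g₂⋯g_{τ((g_n))}, and let m' := ξ_* m^ℕ be the pushforward probability measure on H. Then m' is symmetric (m'(h) = m'(h⁻¹) for all h ∈ H) and the support of m' generates H as a group. -/

import Mathlib

open MeasureTheory
open scoped ENNReal

/-- The word `g₁ g₂ ⋯ gₙ` of a one-sided sequence `g : ℕ → G` (indexed from `0`,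
so `g i` represents `g_{i+1}`). -/
def wordN {G : Type*} [Group G] (g : ℕ → G) (n : ℕ) : G :=
  ((List.range n).map g).prod

/-- `μ` is the one-sided Bernoulli product measure with marginal the weight
function `m`. -/
def IsBernoulliN {G : Type*} [MeasurableSpace G] (m : G → ℝ≥0∞)
    (μ : Measure (ℕ → G)) : Prop :=
  ∀ (s : Finset ℕ) (f : ℕ → G), μ {x | ∀ i ∈ s, x i = f i} = ∏ i ∈ s, m (f i)

/-- `n` is the first-entry time `τ` of the random walk `x` into `H`. -/
def FirstEntry {G : Type*} [Group G] (H : Subgroup G) (x : ℕ → G) (n : ℕ) : Prop :=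
  1 ≤ n ∧ wordN x n ∈ H ∧ ∀ j : ℕ, 1 ≤ j → j < n → wordN x j ∉ H

/-- A nonempty word whose product lies in `H`, while no proper nonempty prefix has product in `H`. -/
def IsFirstEntryWord {G : Type*} [Group G] (H : Subgroup G) (l : List G) : Prop :=
  1 ≤ l.length ∧ l.prod ∈ H ∧ ∀ j : ℕ, 1 ≤ j → j < l.length → (l.take j).prod ∉ H

/-- The sequences that start with the word `l`. -/
def wordCylinder {G : Type*} (l : List G) : Set (ℕ → G) :=
  {x | (List.range l.length).map x = l}

theorem wordCylinder_eq {G : Type*} [Group G] (l : List G) :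
    wordCylinder l = {x | ∀ i ∈ Finset.range l.length, x i = l.getD i 1} := by
  ext x
  simp only [wordCylinder, Set.mem_ofPred_eq, Finset.mem_range]
  constructor
  · intro h i hi
    have h' : ((List.range l.length).map x).getD i 1 = l.getD i 1 := by rw [h]
    simpa [List.getD_eq_getElem?_getD, hi] using h'
  · intro h
    refine List.ext_getElem (by simp) fun i h1 h2 => ?_
    simpa [h2] using h i h2

theorem measurableSet_wordCylinder {G : Type*} [Group G] [MeasurableSpace G]
    [DiscreteMeasurableSpace G] (l : List G) : MeasurableSet (wordCylinder l) := by
  have h : wordCylinder l =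
      ⋂ i ∈ Finset.range l.length, (fun x : ℕ → G => x i) ⁻¹' {l.getD i 1} := by
    rw [wordCylinder_eq]
    ext x
    simp
  rw [h]
  exact Finset.measurableSet_biInter _ fun i _ => measurable_pi_apply i (.of_discrete)

theorem IsBernoulliN.measure_wordCylinder {G : Type*} [Group G] [MeasurableSpace G]
    {m : G → ℝ≥0∞} {μ : Measure (ℕ → G)} (h : IsBernoulliN m μ) (l : List G) :
    μ (wordCylinder l) = (l.map m).prod := by
  rw [wordCylinder_eq, h, Finset.prod_range, ← Fin.prod_univ_fun_getElem]
  simp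

theorem firstEntry_iff {G : Type*} [Group G] (H : Subgroup G) (x : ℕ → G) (n : ℕ) :
    FirstEntry H x n ↔ IsFirstEntryWord H ((List.range n).map x) := by
  have h : ∀ j < n, wordN x j = (((List.range n).map x).take j).prod := by
    intro j hj
    rw [← List.map_take, List.take_range, min_eq_left hj.le, wordN]
  simp only [FirstEntry, IsFirstEntryWord, List.length_map, List.length_range]
  refine and_congr_right fun _ => and_congr Iff.rfl <| forall_congr' fun j =>
    forall_congr' fun _ => forall_congr' fun hj => ?_
  rw [h j hj]

theorem FirstEntry.unique {G : Type*} [Group G] {H : Subgroup G} {x : ℕ → G} {n k : ℕ}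
    (hn : FirstEntry H x n) (hk : FirstEntry H x k) : n = k := by
  rcases lt_trichotomy n k with h | h | h
  · exact absurd hn.2.1 (hk.2.2 n hn.1 h)
  · exact h
  · exact absurd hk.2.1 (hn.2.2 k hk.1 h)

theorem setOf_firstEntry_eq_iUnion {G : Type*} [Group G] (H : Subgroup G) (h : G) :
    {x : ℕ → G | ∃ n : ℕ, FirstEntry H x n ∧ wordN x n = h} =
      ⋃ l : {l : List G // IsFirstEntryWord H l ∧ l.prod = h}, wordCylinder l.1 := by
  ext x
  simp only [Set.mem_ofPred_eq, Set.mem_iUnion, wordCylinder, firstEntry_iff]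
  constructor
  · rintro ⟨n, hn, hw⟩
    exact ⟨⟨_, hn, hw⟩, by simp⟩
  · rintro ⟨⟨l, hl, hp⟩, hx⟩
    exact ⟨l.length, by rwa [hx], by rw [wordN, hx, hp]⟩

theorem pairwise_disjoint_wordCylinder {G : Type*} [Group G] (H : Subgroup G) (h : G) :
    Pairwise (Function.onFun Disjoint
      fun l : {l : List G // IsFirstEntryWord H l ∧ l.prod = h} => wordCylinder l.1) := by
  rintro ⟨l, hl, hp⟩ ⟨k, hk, hq⟩ hne
  refine Set.disjoint_left.2 fun x hx hy => hne (Subtype.ext ?_)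
  simp only [wordCylinder, Set.mem_ofPred_eq] at hx hy
  have hlen : l.length = k.length := FirstEntry.unique (H := H) (x := x)
    ((firstEntry_iff H x _).2 (by rwa [hx])) ((firstEntry_iff H x _).2 (by rwa [hy]))
  exact hx.symm.trans (hlen ▸ hy)

theorem IsBernoulliN.measure_firstEntry {G : Type*} [Group G] [Countable G] [MeasurableSpace G]
    [DiscreteMeasurableSpace G] {m : G → ℝ≥0∞} {μ : Measure (ℕ → G)} (hμ : IsBernoulliN m μ)
    (H : Subgroup G) (h : G) :
    μ {x : ℕ → G | ∃ n : ℕ, FirstEntry H x n ∧ wordN x n = h} =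
      ∑' l : {l : List G // IsFirstEntryWord H l ∧ l.prod = h}, (l.1.map m).prod := by
  rw [setOf_firstEntry_eq_iUnion, measure_iUnion (pairwise_disjoint_wordCylinder H h)
    fun l => measurableSet_wordCylinder l.1]
  simp only [hμ.measure_wordCylinder]

/-- The formal inverse of a word. -/
def invWord {G : Type*} [Group G] (l : List G) : List G := (l.map (·⁻¹)).reverse

theorem invWord_invWord {G : Type*} [Group G] (l : List G) : invWord (invWord l) = l := by
  simp [invWord]

theorem prod_invWord {G : Type*} [Group G] (l : List G) : (invWord l).prod = l.prod⁻¹ :=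
  (List.prod_inv_reverse l).symm

theorem IsFirstEntryWord.invWord {G : Type*} [Group G] {H : Subgroup G} {l : List G}
    (hl : IsFirstEntryWord H l) : IsFirstEntryWord H (invWord l) := by
  obtain ⟨h1, h2, h3⟩ := hl
  have hlen : (_root_.invWord l).length = l.length := by simp [_root_.invWord]
  refine ⟨by rwa [hlen], by rw [prod_invWord]; exact H.inv_mem h2, fun j hj hj' hmem => ?_⟩
  rw [hlen] at hj'
  have ht : (_root_.invWord l).take j = _root_.invWord (l.drop (l.length - j)) := by
    simp [_root_.invWord, List.take_reverse, List.map_drop]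
  rw [ht, prod_invWord, H.inv_mem_iff] at hmem
  rw [← List.prod_take_mul_prod_drop l (l.length - j), H.mul_mem_cancel_right hmem] at h2
  exact h3 _ (by omega) (by omega) h2

/-- Taking formal inverses is a bijection between the first entry words of `h` and of `h⁻¹`. -/
def firstEntryWordEquiv {G : Type*} [Group G] (H : Subgroup G) (h : G) :
    {l : List G // IsFirstEntryWord H l ∧ l.prod = h} ≃
      {l : List G // IsFirstEntryWord H l ∧ l.prod = h⁻¹} where
  toFun l := ⟨invWord l.1, l.2.1.invWord, by rw [prod_invWord, l.2.2]⟩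
  invFun l := ⟨invWord l.1, l.2.1.invWord, by rw [prod_invWord, l.2.2, inv_inv]⟩
  left_inv l := Subtype.ext (invWord_invWord l.1)
  right_inv l := Subtype.ext (invWord_invWord l.1)

theorem prod_map_invWord {G : Type*} [Group G] {m : G → ℝ≥0∞} (hsym : ∀ g : G, m g = m g⁻¹)
    (l : List G) : ((invWord l).map m).prod = (l.map m).prod := by
  simp [invWord, List.map_reverse, List.prod_reverse, Function.comp_def, ← hsym]

/-- A word in letters of positive weight whose product lies in `H` has its product in the
subgroup generated by the products of first entry words in such letters. -/
theorem prod_mem_closure_firstEntryWord {G : Type*} [Group G] (H : Subgroup G) (s : Set G)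
    (l : List G) (hs : ∀ g ∈ l, g ∈ s) (hl : l.prod ∈ H) :
    l.prod ∈ Subgroup.closure
      {h : G | ∃ w : List G, IsFirstEntryWord H w ∧ (∀ g ∈ w, g ∈ s) ∧ w.prod = h} := by
  classical
  induction hn : l.length using Nat.strong_induction_on generalizing l with
  | _ n ih =>
    rcases Nat.eq_zero_or_pos n with h0 | hpos
    · rw [List.length_eq_zero_iff.1 (hn.trans h0)]
      exact Subgroup.one_mem _
    · have hex : ∃ j, 1 ≤ j ∧ (l.take j).prod ∈ H := ⟨n, hpos, by rwa [← hn, List.take_length]⟩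
      obtain ⟨hj1, hjH⟩ := Nat.find_spec hex
      have hjn : Nat.find hex ≤ n := Nat.find_min' hex ⟨hpos, by rwa [← hn, List.take_length]⟩
      have hmin : ∀ i, 1 ≤ i → i < Nat.find hex → (l.take i).prod ∉ H :=
        fun i hi hlt hmem => Nat.find_min hex hlt ⟨hi, hmem⟩
      generalize Nat.find hex = j at hj1 hjH hjn hmin
      have hlen : (l.take j).length = j := by rw [List.length_take]; omega
      rw [← List.prod_take_mul_prod_drop l j] at hl ⊢
      refine Subgroup.mul_mem _ (Subgroup.subset_closure ⟨l.take j, ⟨by rwa [hlen], hjH, ?_⟩,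
        fun g hg => hs g (List.mem_of_mem_take hg), rfl⟩) ?_
      · intro i hi hlt
        rw [hlen] at hlt
        rw [List.take_take, min_eq_left hlt.le]
        exact hmin i hi hlt
      · exact ih (n - j) (by omega) _ (fun g hg => hs g (List.mem_of_mem_drop hg))
          ((H.mul_mem_cancel_left hjH).1 hl) (by rw [List.length_drop, hn])

/-- **The first-return distribution `m' = ξ_* m^ℕ` on a normal subgroup `H` is
symmetric and its support generates `H` as a group.** Here `m' h = μN {x | ξ x = h}`. -/
theorem firstReturn_symmetric_and_generates {G : Type*} [Group G] [Countable G]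
    [MeasurableSpace G] [DiscreteMeasurableSpace G]
    (H : Subgroup G) [H.Normal]
    (m : G → ℝ≥0∞) (hm : ∑' g : G, m g = 1)
    (hsym : ∀ g : G, m g = m g⁻¹)
    (hgen : Subgroup.closure {g : G | m g ≠ 0} = ⊤)
    (μN : Measure (ℕ → G)) [IsProbabilityMeasure μN] (hBern : IsBernoulliN m μN)
    (hτ : ∀ᵐ x ∂μN, ∃ n : ℕ, FirstEntry H x n) :
    (∀ h : G, μN {x : ℕ → G | ∃ n : ℕ, FirstEntry H x n ∧ wordN x n = h}
      = μN {x : ℕ → G | ∃ n : ℕ, FirstEntry H x n ∧ wordN x n = h⁻¹}) ∧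
    Subgroup.closure
      {h : G | μN {x : ℕ → G | ∃ n : ℕ, FirstEntry H x n ∧ wordN x n = h} ≠ 0} = H := by
  constructor
  · intro h
    rw [hBern.measure_firstEntry, hBern.measure_firstEntry,
      ← (firstEntryWordEquiv H h).tsum_eq]
    exact tsum_congr fun l => (prod_map_invWord hsym l.1).symm
  · apply le_antisymm
    · rw [Subgroup.closure_le]
      intro h hh
      obtain ⟨x, n, hx, rfl⟩ := nonempty_of_measure_ne_zero hh
      exact hx.2.1
    · intro h hh
      have hmem : h ∈ (Subgroup.closure {g : G | m g ≠ 0}).toSubmonoid := by simp [hgen]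
      rw [Subgroup.closure_toSubmonoid] at hmem
      obtain ⟨l, hl, rfl⟩ := Submonoid.exists_list_of_mem_closure hmem
      have hpos : ∀ g ∈ l, g ∈ {g : G | m g ≠ 0} := fun g hg =>
        (hl g hg).elim id fun h' => by rwa [Set.mem_ofPred_eq, hsym]
      refine Subgroup.closure_mono ?_ (prod_mem_closure_firstEntryWord H _ l hpos hh)
      rintro _ ⟨w, hw, hws, rfl⟩
      rw [Set.mem_ofPred_eq, hBern.measure_firstEntry, ne_eq, ENNReal.tsum_eq_zero]
      intro h0
      have hzero := h0 ⟨w, hw, rfl⟩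
      rw [List.prod_eq_zero_iff, List.mem_map] at hzero
      obtain ⟨g, hg, hg0⟩ := hzero
      exact hws g hg hg0
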